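/- arXiv:2011.03916 — 2 statements merged into one kernel-verified Lean document; each statement's English description precedes it below -/
import Mathlib

section
/- Let d ∈ (0,1). Since g^M_d maps [0,1] into [0,1], its n-fold iterate (g^M_d)^{∘n} is well defined on [0,1] for every natural number n, and for every n there exists a constant C_n > 0 such that for all ω ∈ [0,1], |(g^M_d)^{∘n}(ω) − d| ≤ C_n·|ω − d|^{3^n}. -/
/-- The WENO-M mapping function `g^M_d`. -/
noncomputable def gM (d ω : ℝ) : ℝ :=
  ω * (d + d ^ 2 - 3 * d * ω + ω ^ 2) / (d ^ 2 + (1 - 2 * d) * ω)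

theorem gM_denom_lower_bound {d ω : ℝ} (hω : ω ∈ Set.Icc (0 : ℝ) 1) :
    min (d ^ 2) ((1 - d) ^ 2) ≤ d ^ 2 + (1 - 2 * d) * ω := by
  obtain ⟨h0, h1⟩ := hω
  have h := add_le_add
    (mul_le_mul_of_nonneg_right (min_le_left (d ^ 2) ((1 - d) ^ 2)) (sub_nonneg.2 h1))
    (mul_le_mul_of_nonneg_right (min_le_right (d ^ 2) ((1 - d) ^ 2)) h0)
  linarith

theorem min_sq_pos {d : ℝ} (hd : d ∈ Set.Ioo (0 : ℝ) 1) : 0 < min (d ^ 2) ((1 - d) ^ 2) :=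
  lt_min (pow_pos hd.1 2) (pow_pos (sub_pos.2 hd.2) 2)

theorem gM_denom_pos {d ω : ℝ} (hd : d ∈ Set.Ioo (0 : ℝ) 1) (hω : ω ∈ Set.Icc (0 : ℝ) 1) :
    0 < d ^ 2 + (1 - 2 * d) * ω :=
  (min_sq_pos hd).trans_le (gM_denom_lower_bound hω)

theorem gM_sub_self {d ω : ℝ} (hd : d ∈ Set.Ioo (0 : ℝ) 1) (hω : ω ∈ Set.Icc (0 : ℝ) 1) :
    gM d ω - d = (ω - d) ^ 3 / (d ^ 2 + (1 - 2 * d) * ω) := by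
  have h := (gM_denom_pos hd hω).ne'
  rw [gM, div_sub' h]
  congr 1
  ring

theorem gM_quadratic_nonneg {d ω : ℝ} (hd : d ∈ Set.Ioo (0 : ℝ) 1)
    (hω : ω ∈ Set.Icc (0 : ℝ) 1) : 0 ≤ d + d ^ 2 - 3 * d * ω + ω ^ 2 := by
  obtain ⟨h0, h1⟩ := hω
  obtain ⟨hd0, hd1⟩ := hd
  rcases le_total d (4 / 5) with h | h
  · nlinarith [sq_nonneg (2 * ω - 3 * d), mul_nonneg hd0.le (sub_nonneg.2 h)]
  · nlinarith [sq_nonneg (1 - d),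
      mul_nonneg (sub_nonneg.2 h1) (by linarith : 0 ≤ 3 * d - 1 - ω)]

theorem gM_nonneg {d ω : ℝ} (hd : d ∈ Set.Ioo (0 : ℝ) 1) (hω : ω ∈ Set.Icc (0 : ℝ) 1) :
    0 ≤ gM d ω :=
  div_nonneg (mul_nonneg hω.1 (gM_quadratic_nonneg hd hω)) (gM_denom_pos hd hω).le

theorem gM_one_sub {d ω : ℝ} (hd : d ∈ Set.Ioo (0 : ℝ) 1) (hω : ω ∈ Set.Icc (0 : ℝ) 1) :
    gM (1 - d) (1 - ω) = 1 - gM d ω := by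
  have h := (gM_denom_pos hd hω).ne'
  have hden : (1 - d) ^ 2 + (1 - 2 * (1 - d)) * (1 - ω) = d ^ 2 + (1 - 2 * d) * ω := by ring
  rw [gM, gM, hden, one_sub_div h]
  congr 1
  ring

theorem gM_mem_Icc {d ω : ℝ} (hd : d ∈ Set.Ioo (0 : ℝ) 1) (hω : ω ∈ Set.Icc (0 : ℝ) 1) :
    gM d ω ∈ Set.Icc (0 : ℝ) 1 := by
  refine ⟨gM_nonneg hd hω, ?_⟩
  have h := gM_nonneg (d := 1 - d) (ω := 1 - ω)
    ⟨sub_pos.2 hd.2, sub_lt_self 1 hd.1⟩ ⟨sub_nonneg.2 hω.2, sub_le_self 1 hω.1⟩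
  rw [gM_one_sub hd hω] at h
  exact sub_nonneg.1 h

theorem abs_gM_sub_le {d ω : ℝ} (hd : d ∈ Set.Ioo (0 : ℝ) 1) (hω : ω ∈ Set.Icc (0 : ℝ) 1) :
    |gM d ω - d| ≤ (min (d ^ 2) ((1 - d) ^ 2))⁻¹ * |ω - d| ^ 3 := by
  rw [gM_sub_self hd hω, abs_div, abs_pow, abs_of_pos (gM_denom_pos hd hω), div_eq_inv_mul]
  gcongr
  · exact min_sq_pos hd
  · exact gM_denom_lower_bound hω

theorem stmt_4 (d : ℝ) (hd : d ∈ Set.Ioo (0 : ℝ) 1) :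
    (∀ ω ∈ Set.Icc (0 : ℝ) 1, gM d ω ∈ Set.Icc (0 : ℝ) 1) ∧
    ∀ n : ℕ, ∃ C : ℝ, 0 < C ∧ ∀ ω ∈ Set.Icc (0 : ℝ) 1,
      |(gM d)^[n] ω - d| ≤ C * |ω - d| ^ (3 ^ n) := by
  refine ⟨fun ω hω => gM_mem_Icc hd hω, fun n => ?_⟩
  induction n with
  | zero => exact ⟨1, one_pos, fun ω _ => by simp⟩
  | succ n ih =>
    obtain ⟨C, hC, h⟩ := ih
    have hK := inv_pos.2 (min_sq_pos hd)
    set K := (min (d ^ 2) ((1 - d) ^ 2))⁻¹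
    refine ⟨C * K ^ 3 ^ n, by positivity, fun ω hω => ?_⟩
    calc |(gM d)^[n + 1] ω - d| ≤ C * |gM d ω - d| ^ 3 ^ n := h _ (gM_mem_Icc hd hω)
      _ ≤ C * (K * |ω - d| ^ 3) ^ 3 ^ n := by
        gcongr
        exact abs_gM_sub_le hd hω
      _ = C * K ^ 3 ^ n * |ω - d| ^ 3 ^ (n + 1) := by
        rw [mul_pow, ← pow_mul, ← pow_succ', mul_assoc]
end

section
/- Let d ∈ (0,1), let k be a positive even integer and A > 0. There exists a constant C > 0 such that for all ω ∈ [0,1], |g^IM(ω) − d| ≤ C·|ω − d|^{k+1}. -/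
/-- The WENO-IM(k, A) mapping function. -/
noncomputable def gIM (d A : ℝ) (k : ℕ) (ω : ℝ) : ℝ :=
  d + A * (ω - d) ^ (k + 1) / (A * (ω - d) ^ k + ω * (1 - ω))

/-- The denominator of the WENO-IM mapping function is positive on `[0, 1]`. -/
theorem gIM_denom_pos {d A : ℝ} (hd : d ∈ Set.Ioo (0 : ℝ) 1) {k : ℕ} (hke : Even k)
    (hA : 0 < A) {ω : ℝ} (hω : ω ∈ Set.Icc (0 : ℝ) 1) :
    0 < A * (ω - d) ^ k + ω * (1 - ω) := by
  obtain ⟨h0, h1⟩ := hω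
  have hpow : 0 ≤ A * (ω - d) ^ k := mul_nonneg hA.le (hke.pow_nonneg _)
  rcases eq_or_ne ω d with rfl | hne
  · exact add_pos_of_nonneg_of_pos hpow (mul_pos hd.1 (sub_pos.2 hd.2))
  · exact add_pos_of_pos_of_nonneg (mul_pos hA (hke.pow_pos (sub_ne_zero.2 hne)))
      (mul_nonneg h0 (sub_nonneg.2 h1))

theorem stmt_8 (d : ℝ) (hd : d ∈ Set.Ioo (0 : ℝ) 1)
    (k : ℕ) (hk : 0 < k) (hke : Even k) (A : ℝ) (hA : 0 < A) :
    ∃ C : ℝ, 0 < C ∧ ∀ ω ∈ Set.Icc (0 : ℝ) 1,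
      |gIM d A k ω - d| ≤ C * |ω - d| ^ (k + 1) := by
  obtain ⟨ω₀, hω₀, hmin⟩ := isCompact_Icc.exists_isMinOn (Set.nonempty_Icc.2 zero_le_one)
    (f := fun ω : ℝ => A * (ω - d) ^ k + ω * (1 - ω)) (by fun_prop)
  have hm := gIM_denom_pos hd hke hA hω₀
  refine ⟨A / (A * (ω₀ - d) ^ k + ω₀ * (1 - ω₀)), div_pos hA hm, fun ω hω => ?_⟩
  have hle : A * (ω₀ - d) ^ k + ω₀ * (1 - ω₀) ≤ A * (ω - d) ^ k + ω * (1 - ω) := hmin hω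
  rw [gIM, add_sub_cancel_left, abs_div, abs_mul, abs_pow, abs_of_pos hA,
    abs_of_pos (gIM_denom_pos hd hke hA hω), div_mul_eq_mul_div]
  exact div_le_div_of_nonneg_left (by positivity) hm hle
end
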